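/- Let d ≥ 3, h > 0, T > 0, and let ξ^(h) be the unique global solution of (d/dt) ξ^(h) = 𝓕^(h)(ξ^(h)), ξ^(h)(0) = ξ₀. Then sup_{t ≥ T} |F^(h)(ξ^(h))(t) − F^(0)(ξ^(h))(t)| ≤ C_g^3 (h/T)^{d/2 − 1}, where C_g^3 = (d/2 − 1) π^{d/2} ‖ĝ‖_{L¹}. -/

import Mathlib

open MeasureTheory Filter Set
open scoped RealInnerProductSpace Topology ENNReal

noncomputable section

abbrev E (d : ℕ) := EuclideanSpace ℝ (Fin d)

/-- `g(η) = η |f(η)|²`. -/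
def gfun {d : ℕ} (f : SchwartzMap (E d) ℂ) (η : E d) : E d := ‖f η‖ ^ 2 • η

/-- the average `⨍_a^b u(σ) dσ`. -/
def intAvg {d : ℕ} (u : ℝ → E d) (a b : ℝ) : E d := (b - a)⁻¹ • ∫ σ in a..b, u σ

/-- `𝓕^(h)(u)(t)`; since `g` is real-valued, taking the real part of the complex
integral amounts to replacing `e^{-irθ}` by `cos (rθ)`. -/
def calF {d : ℕ} (f : SchwartzMap (E d) ℂ) (h : ℝ) (u : ℝ → E d) (t : ℝ) : E d :=
  (-2 : ℝ) • ∫ η, (∫ r in (0:ℝ)..(t / h),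
    Real.cos (r * (‖η‖ ^ 2 - 2 * ⟪η, intAvg u (t - h * r) t⟫))) • gfun f η

/-- the `i`-th component of the Fourier transform `ĝ(x) = (2π)^{-d/2} ∫ e^{-ix·η} g(η) dη`. -/
def ftGi {d : ℕ} (f : SchwartzMap (E d) ℂ) (i : Fin d) (x : E d) : ℂ :=
  ((2 * Real.pi) ^ (-(d : ℝ) / 2) : ℝ) *
    ∫ η, Complex.exp (-Complex.I * (⟪x, η⟫ : ℝ)) * ((gfun f η i : ℝ) : ℂ)

/-- `‖g‖_{L¹}`. -/
def L1g {d : ℕ} (f : SchwartzMap (E d) ℂ) : ℝ := ∫ η, ‖gfun f η‖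

/-- `‖ĝ‖_{L¹}` (with the euclidean norm of the complex vector `ĝ(x)`). -/
def L1ftg {d : ℕ} (f : SchwartzMap (E d) ℂ) : ℝ :=
  ∫ x, Real.sqrt (∑ i, ‖ftGi f i x‖ ^ 2)

/-- `C_g^1 = ‖g‖_{L¹} + (d/2 − 1) π^{d/2} ‖ĝ‖_{L¹}`. -/
def Cg1 {d : ℕ} (f : SchwartzMap (E d) ℂ) : ℝ :=
  L1g f + ((d : ℝ) / 2 - 1) * Real.pi ^ ((d : ℝ) / 2) * L1ftg f

/-- the inner integral `∫_{ℝ^d} e^{-ir(|η|²-2η·u)} g(η) dη` (the real part being taken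
componentwise, `e^{-irθ}` contributes `cos (rθ)` since `g` is real). -/
def F0inner {d : ℕ} (f : SchwartzMap (E d) ℂ) (r : ℝ) (u : E d) : E d :=
  ∫ η, Real.cos (r * (‖η‖ ^ 2 - 2 * ⟪η, u⟫)) • gfun f η

/-- `F^(0)(u) = −2 Re ∫_0^∞ (∫ e^{−ir(|η|²−2η·u)} η |f(η)|² dη) dr`, as the improper
integral in `r` (i.e. the limit of the integrals over `[0,R]` as `R → ∞`). -/
def F0pt {d : ℕ} (f : SchwartzMap (E d) ℂ) (u : E d) : E d :=
  limUnder atTop fun R : ℝ => ∫ r in (0:ℝ)..R, (-2 : ℝ) • F0inner f r u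

/-- `F^(h)(u)(t)`, where the memory average is replaced by the instantaneous value `u(t)`. -/
def Fh {d : ℕ} (f : SchwartzMap (E d) ℂ) (h : ℝ) (u : ℝ → E d) (t : ℝ) : E d :=
  (-2 : ℝ) • ∫ η, (∫ r in (0:ℝ)..(t / h),
    Real.cos (r * (‖η‖ ^ 2 - 2 * ⟪η, u t⟫))) • gfun f η

/-- `C_g^3 = (d/2 − 1) π^{d/2} ‖ĝ‖_{L¹}`. -/
def Cg3 {d : ℕ} (f : SchwartzMap (E d) ℂ) : ℝ :=
  ((d : ℝ) / 2 - 1) * Real.pi ^ ((d : ℝ) / 2) * L1ftg f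

open scoped SchwartzMap FourierTransform

theorem norm_fourier_gaussian_le {V : Type*} [NormedAddCommGroup V] [InnerProductSpace ℝ V]
    [FiniteDimensional ℝ V] [MeasurableSpace V] [BorelSpace V] {b : ℂ} (hb : 0 < b.re) (x w : V) :
    ‖𝓕 (fun v : V ↦ Complex.exp (-b * ‖v‖ ^ 2 + 2 * Real.pi * Complex.I * ⟪x, v⟫)) w‖ ≤
      (Real.pi / ‖b‖) ^ ((Module.finrank ℝ V : ℝ) / 2) := by
  rw [fourier_gaussian_innerProductSpace' hb, norm_mul]
  have h1 : ((Module.finrank ℝ V : ℂ) / 2) = (((Module.finrank ℝ V : ℝ) / 2 : ℝ) : ℂ) := by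
    push_cast; rfl
  rw [h1, Complex.norm_cpow_real, norm_div, Complex.norm_real, Real.norm_of_nonneg Real.pi_pos.le,
    Complex.norm_exp]
  refine mul_le_of_le_one_right (by positivity) (Real.exp_le_one_iff.2 ?_)
  have h2 : (-(Real.pi : ℂ) ^ 2 * (‖x - w‖ : ℂ) ^ 2 / b) =
      ((-(Real.pi ^ 2 * ‖x - w‖ ^ 2) : ℝ) : ℂ) * b⁻¹ := by
    push_cast; ring
  rw [h2, Complex.re_ofReal_mul, Complex.inv_re]
  have : 0 ≤ Real.pi ^ 2 * ‖x - w‖ ^ 2 * (b.re / Complex.normSq b) := by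
    have := Complex.normSq_nonneg b
    positivity
  linarith

theorem norm_integral_gaussian_smul_le {V F : Type*} [NormedAddCommGroup V]
    [InnerProductSpace ℝ V] [FiniteDimensional ℝ V] [MeasurableSpace V] [BorelSpace V]
    [NormedAddCommGroup F] [NormedSpace ℂ F] [CompleteSpace F] (G : 𝓢(V, F))
    {b : ℂ} (hb : 0 < b.re) (x : V) :
    ‖∫ v, Complex.exp (-b * ‖v‖ ^ 2 + 2 * Real.pi * Complex.I * ⟪x, v⟫) • G v‖ ≤
      (Real.pi / ‖b‖) ^ ((Module.finrank ℝ V : ℝ) / 2) * ∫ v, ‖𝓕 G v‖ := by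
  set H : 𝓢(V, F) := 𝓕⁻ G with hH
  have hG : G = 𝓕 H := by simp [hH]
  set q : V → ℂ := fun v ↦ Complex.exp (-b * ‖v‖ ^ 2 + 2 * Real.pi * Complex.I * ⟪x, v⟫) with hq
  have hqi : Integrable q :=
    GaussianFourier.integrable_cexp_neg_mul_sq_norm_add hb (2 * Real.pi * Complex.I) x
  have key : ∫ v, q v • G v = ∫ w, 𝓕 q w • H w := by
    rw [hG, SchwartzMap.fourier_coe]
    simpa using! (VectorFourier.integral_fourierIntegral_smul_eq_flip (L := innerₗ V)
      Real.continuous_fourierChar continuous_inner hqi H.integrable).symm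
  rw [key]
  have hn : ∫ w, ‖H w‖ = ∫ v, ‖𝓕 G v‖ := by
    rw [← integral_neg_eq_self]
    congr 1 with w
    rw [hH, SchwartzMap.fourierInv_coe, SchwartzMap.fourier_coe, Real.fourierInv_eq_fourier_neg,
      neg_neg]
  rw [← hn, ← integral_const_mul]
  refine norm_integral_le_of_norm_le (H.integrable.norm.const_mul _) (.of_forall fun w ↦ ?_)
  rw [norm_smul]
  gcongr
  exact norm_fourier_gaussian_le hb x w

theorem norm_integral_oscillatory_smul_le {V F : Type*} [NormedAddCommGroup V]
    [InnerProductSpace ℝ V] [FiniteDimensional ℝ V] [MeasurableSpace V] [BorelSpace V]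
    [NormedAddCommGroup F] [NormedSpace ℂ F] [CompleteSpace F] (G : 𝓢(V, F))
    {r : ℝ} (hr : 0 < r) (u : V) :
    ‖∫ v, Complex.exp (-Complex.I * (r * (‖v‖ ^ 2 - 2 * ⟪v, u⟫) : ℝ)) • G v‖ ≤
      (Real.pi / r) ^ ((Module.finrank ℝ V : ℝ) / 2) * ∫ v, ‖𝓕 G v‖ := by
  have hlim : Tendsto (fun ε : ℝ ↦ ∫ v, Complex.exp (-(ε + r * Complex.I) * ‖v‖ ^ 2 +
      2 * Real.pi * Complex.I * ⟪(r / Real.pi) • u, v⟫) • G v) (𝓝[>] 0)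
      (𝓝 (∫ v, Complex.exp (-Complex.I * (r * (‖v‖ ^ 2 - 2 * ⟪v, u⟫) : ℝ)) • G v)) := by
    refine tendsto_integral_filter_of_dominated_convergence (fun v ↦ ‖G v‖) ?_ ?_
      G.integrable.norm ?_
    · refine .of_forall fun ε ↦ (Continuous.smul ?_ G.continuous).aestronglyMeasurable
      fun_prop
    · filter_upwards [self_mem_nhdsWithin] with ε (hε : 0 < ε)
      refine .of_forall fun v ↦ ?_
      rw [norm_smul, Complex.norm_exp]
      refine mul_le_of_le_one_left (norm_nonneg _) (Real.exp_le_one_iff.2 ?_)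
      have : (-(ε + r * Complex.I) * (‖v‖ : ℂ) ^ 2 +
          2 * Real.pi * Complex.I * (⟪(r / Real.pi) • u, v⟫ : ℝ)).re = -(ε * ‖v‖ ^ 2) := by
        simp [← Complex.ofReal_pow]
      rw [this]
      have : 0 ≤ ε * ‖v‖ ^ 2 := by positivity
      linarith
    · refine .of_forall fun v ↦ ?_
      have hc : Continuous fun ε : ℝ ↦ Complex.exp (-(ε + r * Complex.I) * ‖v‖ ^ 2 +
          2 * Real.pi * Complex.I * (⟪(r / Real.pi) • u, v⟫ : ℝ)) • G v := by fun_prop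
      have h0 := (hc.tendsto 0).mono_left (nhdsWithin_le_nhds (s := Ioi 0))
      convert h0 using 4
      rw [real_inner_smul_left, real_inner_comm]
      push_cast
      field_simp
      ring
  refine le_of_tendsto hlim.norm ?_
  filter_upwards [self_mem_nhdsWithin] with ε (hε : 0 < ε)
  have hb : 0 < ((ε : ℂ) + r * Complex.I).re := by simpa using hε
  refine (norm_integral_gaussian_smul_le G hb _).trans ?_
  have hle : r ≤ ‖(ε : ℂ) + r * Complex.I‖ := by
    have := Complex.abs_im_le_norm ((ε : ℂ) + r * Complex.I)
    simpa [abs_of_pos hr] using this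
  have : 0 ≤ ∫ v, ‖𝓕 G v‖ := integral_nonneg fun _ ↦ norm_nonneg _
  gcongr

/-- The componentwise inclusion of the real into the complex Euclidean space. -/
def complexifyCLM (d : ℕ) : E d →L[ℝ] EuclideanSpace ℂ (Fin d) :=
  LinearMap.toContinuousLinearMap
    { toFun := fun η ↦ WithLp.toLp 2 fun i ↦ ((η i : ℝ) : ℂ)
      map_add' := fun x y ↦ by ext i; simp
      map_smul' := fun c x ↦ by ext i; simp }

theorem exists_schwartzMap_complexify_gfun {d : ℕ} (f : SchwartzMap (E d) ℂ) :
    ∃ G : 𝓢(E d, EuclideanSpace ℂ (Fin d)), ∀ η i, G η i = ((gfun f η i : ℝ) : ℂ) := by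
  have h1 : (fun η : E d ↦ (starRingEnd ℂ (f η)) • complexifyCLM d η).HasTemperateGrowth := by
    refine Function.HasTemperateGrowth.smul (f := fun η ↦ starRingEnd ℂ (f η)) ?_
      (complexifyCLM d).hasTemperateGrowth
    exact (Complex.conjCLE.toContinuousLinearMap.hasTemperateGrowth).comp f.hasTemperateGrowth
  refine ⟨SchwartzMap.bilinLeftCLM
    (ContinuousLinearMap.lsmul ℂ ℂ (E := EuclideanSpace ℂ (Fin d))) h1 f, fun η i ↦ ?_⟩
  simp [SchwartzMap.bilinLeftCLM_apply, gfun, complexifyCLM, ← mul_assoc, Complex.conj_mul']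

theorem norm_gfun_eq {d : ℕ} {f : SchwartzMap (E d) ℂ} {G : 𝓢(E d, EuclideanSpace ℂ (Fin d))}
    (hG : ∀ η i, G η i = ((gfun f η i : ℝ) : ℂ)) (η : E d) : ‖gfun f η‖ = ‖G η‖ := by
  simp [EuclideanSpace.norm_eq, hG]

theorem continuous_gfun {d : ℕ} (f : SchwartzMap (E d) ℂ) : Continuous (gfun f) := by
  have := f.continuous
  unfold gfun
  fun_prop

theorem integrable_gfun {d : ℕ} (f : SchwartzMap (E d) ℂ) : Integrable (gfun f) := by
  obtain ⟨G, hG⟩ := exists_schwartzMap_complexify_gfun f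
  exact G.integrable.mono (continuous_gfun f).aestronglyMeasurable
    (.of_forall fun η ↦ (norm_gfun_eq hG η).le)

theorem integral_euclideanSpace_apply {α 𝕜 ι : Type*} [MeasurableSpace α] {μ : Measure α}
    [RCLike 𝕜] [Fintype ι] {φ : α → EuclideanSpace 𝕜 ι} (hφ : Integrable φ μ) (i : ι) :
    (∫ a, φ a ∂μ) i = ∫ a, φ a i ∂μ :=
  ((EuclideanSpace.proj (𝕜 := 𝕜) i).integral_comp_comm hφ).symm

theorem ftGi_eq_fourier {d : ℕ} {f : SchwartzMap (E d) ℂ}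
    {G : 𝓢(E d, EuclideanSpace ℂ (Fin d))} (hG : ∀ η i, G η i = ((gfun f η i : ℝ) : ℂ))
    (i : Fin d) (x : E d) :
    ftGi f i x = ((2 * Real.pi) ^ (-(d : ℝ) / 2) : ℝ) * 𝓕 G ((2 * Real.pi)⁻¹ • x) i := by
  rw [ftGi, SchwartzMap.fourier_coe, Real.fourier_eq', integral_euclideanSpace_apply]
  · congr 2 with η
    rw [PiLp.smul_apply, hG, smul_eq_mul, real_inner_smul_right, real_inner_comm]
    congr 2
    push_cast
    have : (Real.pi : ℂ) ≠ 0 := by exact_mod_cast Real.pi_ne_zero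
    field_simp
  · refine G.integrable.mono (Continuous.aestronglyMeasurable ?_) (.of_forall fun η ↦ ?_)
    · have := G.continuous
      fun_prop
    · rw [norm_smul, Complex.norm_exp_ofReal_mul_I, one_mul]

theorem integral_norm_fourier_eq {d : ℕ} {f : SchwartzMap (E d) ℂ}
    {G : 𝓢(E d, EuclideanSpace ℂ (Fin d))} (hG : ∀ η i, G η i = ((gfun f η i : ℝ) : ℂ)) :
    ∫ v, ‖𝓕 G v‖ = (2 * Real.pi) ^ (-(d : ℝ) / 2) * L1ftg f := by
  have hpi : (0 : ℝ) < 2 * Real.pi := by positivity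
  have h1 : ∀ x, √(∑ i, ‖ftGi f i x‖ ^ 2) =
      (2 * Real.pi) ^ (-(d : ℝ) / 2) * ‖𝓕 G ((2 * Real.pi)⁻¹ • x)‖ := by
    intro x
    simp_rw [ftGi_eq_fourier hG, norm_mul, mul_pow, ← Finset.mul_sum]
    rw [Real.sqrt_mul (by positivity), Real.sqrt_sq (norm_nonneg _), EuclideanSpace.norm_eq,
      Complex.norm_real, Real.norm_of_nonneg (by positivity)]
  simp_rw [L1ftg, h1]
  rw [integral_const_mul, Measure.integral_comp_inv_smul_of_nonneg volume
    (fun y ↦ ‖𝓕 G y‖) hpi.le, finrank_euclideanSpace_fin, smul_eq_mul, ← mul_assoc, ← mul_assoc,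
    ← Real.rpow_natCast, ← Real.rpow_add hpi, ← Real.rpow_add hpi]
  ring_nf
  simp

theorem norm_cos_smul_gfun_le {d : ℕ} (f : SchwartzMap (E d) ℂ) (θ : ℝ) (η : E d) :
    ‖Real.cos θ • gfun f η‖ ≤ ‖gfun f η‖ := by
  rw [norm_smul]
  exact mul_le_of_le_one_left (norm_nonneg _) (Real.abs_cos_le_one _)

theorem integrable_cos_smul_gfun {d : ℕ} (f : SchwartzMap (E d) ℂ) (r : ℝ) (u : E d) :
    Integrable fun η ↦ Real.cos (r * (‖η‖ ^ 2 - 2 * ⟪η, u⟫)) • gfun f η := by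
  have := continuous_gfun f
  exact (integrable_gfun f).mono (Continuous.aestronglyMeasurable (by fun_prop))
    (.of_forall fun η ↦ norm_cos_smul_gfun_le f _ η)

theorem norm_F0inner_le {d : ℕ} (f : SchwartzMap (E d) ℂ) {r : ℝ} (hr : 0 < r) (u : E d) :
    ‖F0inner f r u‖ ≤ 2 ^ (-(d : ℝ) / 2) * L1ftg f * r ^ (-(d : ℝ) / 2) := by
  obtain ⟨G, hG⟩ := exists_schwartzMap_complexify_gfun f
  have hGi : Integrable fun v ↦
      Complex.exp (-Complex.I * (r * (‖v‖ ^ 2 - 2 * ⟪v, u⟫) : ℝ)) • G v := by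
    have := G.continuous
    refine G.integrable.mono (Continuous.aestronglyMeasurable (by fun_prop)) (.of_forall fun v ↦ ?_)
    rw [norm_smul, neg_mul, ← mul_neg, ← Complex.ofReal_neg, Complex.norm_exp_I_mul_ofReal,
      one_mul]
  set w := ∫ v, Complex.exp (-Complex.I * (r * (‖v‖ ^ 2 - 2 * ⟪v, u⟫) : ℝ)) • G v with hw
  have hle : ‖F0inner f r u‖ ≤ ‖w‖ := by
    rw [EuclideanSpace.norm_eq, EuclideanSpace.norm_eq]
    gcongr with i
    have hi : (F0inner f r u) i = (w i).re := by
      rw [F0inner, hw, integral_euclideanSpace_apply, integral_euclideanSpace_apply]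
      · rw [← RCLike.re_eq_complex_re, ← integral_re]
        · congr 1 with η
          simp [hG, Complex.exp_re, -Complex.ofReal_pow, -Complex.ofReal_cos]
        · exact hGi.eval_piLp i
      · exact hGi
      · exact integrable_cos_smul_gfun f r u
    rw [hi]
    exact Complex.abs_re_le_norm _
  refine hle.trans ((norm_integral_oscillatory_smul_le G hr u).trans_eq ?_)
  rw [integral_norm_fourier_eq hG, finrank_euclideanSpace_fin, Real.div_rpow Real.pi_pos.le hr.le,
    Real.mul_rpow zero_le_two Real.pi_pos.le, neg_div, Real.rpow_neg Real.pi_pos.le,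
    Real.rpow_neg hr.le]
  field_simp

theorem continuous_F0inner {d : ℕ} (f : SchwartzMap (E d) ℂ) (u : E d) :
    Continuous fun r ↦ F0inner f r u := by
  refine continuous_of_dominated (bound := fun η ↦ ‖gfun f η‖)
    (fun r ↦ (integrable_cos_smul_gfun f r u).aestronglyMeasurable)
    (fun r ↦ .of_forall fun η ↦ norm_cos_smul_gfun_le f _ η) (integrable_gfun f).norm
    (.of_forall fun η ↦ by fun_prop)

theorem Fh_eq_intervalIntegral {d : ℕ} (f : SchwartzMap (E d) ℂ) (h : ℝ) (u : ℝ → E d) (t : ℝ) :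
    Fh f h u t = ∫ r in (0 : ℝ)..(t / h), (-2 : ℝ) • F0inner f r (u t) := by
  rw [intervalIntegral.integral_smul, Fh]
  simp_rw [F0inner, ← intervalIntegral.integral_smul_const]
  rw [intervalIntegral_integral_swap]
  have := continuous_gfun f
  have : IsFiniteMeasure (volume.restrict (uIoc 0 (t / h))) :=
    inferInstanceAs (IsFiniteMeasure (volume.restrict (Ioc _ _)))
  refine ((integrable_gfun f).comp_snd (volume.restrict (uIoc 0 (t / h)))).mono
    (Continuous.aestronglyMeasurable (by unfold Function.uncurry; fun_prop))
    (.of_forall fun p ↦ norm_cos_smul_gfun_le f _ p.2)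

theorem integrableOn_F0inner {d : ℕ} (hd : 3 ≤ d) (f : SchwartzMap (E d) ℂ) (u : E d) {a : ℝ}
    (ha : 0 < a) : IntegrableOn (fun r ↦ F0inner f r u) (Ioi a) := by
  have hd' : (3 : ℝ) ≤ d := by exact_mod_cast hd
  refine Integrable.mono' ((integrableOn_Ioi_rpow_of_lt
    (by linarith : -(d : ℝ) / 2 < -1) ha).const_mul (2 ^ (-(d : ℝ) / 2) * L1ftg f))
    (continuous_F0inner f u).aestronglyMeasurable ?_
  filter_upwards [ae_restrict_mem measurableSet_Ioi] with r hr
  exact norm_F0inner_le f (ha.trans hr) u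

theorem F0pt_eq_add {d : ℕ} (hd : 3 ≤ d) (f : SchwartzMap (E d) ℂ) (u : E d) {a : ℝ}
    (ha : 0 < a) :
    F0pt f u = (∫ r in (0 : ℝ)..a, (-2 : ℝ) • F0inner f r u) +
      ∫ r in Ioi a, (-2 : ℝ) • F0inner f r u := by
  have hc : Continuous fun r ↦ (-2 : ℝ) • F0inner f r u := 
    (continuous_F0inner f u).const_smul (-2 : ℝ)
  refine Tendsto.limUnder_eq (Tendsto.congr (fun R ↦
    intervalIntegral.integral_add_adjacent_intervals (hc.intervalIntegrable 0 a)
      (hc.intervalIntegrable a R)) ?_)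
  exact tendsto_const_nhds.add (intervalIntegral_tendsto_integral_Ioi a
    ((integrableOn_F0inner hd f u ha).smul (-2 : ℝ)) tendsto_id)

theorem norm_integral_Ioi_F0inner_le {d : ℕ} (hd : 3 ≤ d) (f : SchwartzMap (E d) ℂ) (u : E d)
    {a : ℝ} (ha : 0 < a) :
    ‖∫ r in Ioi a, F0inner f r u‖ ≤
      2 ^ (-(d : ℝ) / 2) * L1ftg f * (a ^ (1 - (d : ℝ) / 2) / ((d : ℝ) / 2 - 1)) := by
  have hd' : (3 : ℝ) ≤ d := by exact_mod_cast hd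
  have hlt : -(d : ℝ) / 2 < -1 := by linarith
  refine (norm_integral_le_of_norm_le ((integrableOn_Ioi_rpow_of_lt hlt ha).const_mul
    (2 ^ (-(d : ℝ) / 2) * L1ftg f)) ?_).trans_eq ?_
  · filter_upwards [ae_restrict_mem measurableSet_Ioi] with r hr
    exact norm_F0inner_le f (ha.trans hr) u
  · rw [integral_const_mul, integral_Ioi_rpow_of_lt hlt ha, ← neg_sub 1 ((d : ℝ) / 2),
      (by ring : -(d : ℝ) / 2 + 1 = 1 - (d : ℝ) / 2), div_neg, ← neg_div (1 - (d : ℝ) / 2)]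

theorem two_mul_two_rpow_div_le {s : ℝ} (hs : 3 / 2 ≤ s) :
    2 * 2 ^ (-s) / (s - 1) ≤ (s - 1) * Real.pi ^ s := by
  have h6 : (6 : ℝ) ≤ 2 * Real.pi := by linarith [Real.pi_gt_three]
  have h1 : (8 : ℝ) ≤ (2 * Real.pi) ^ s := by
    calc (8 : ℝ) ≤ 6 ^ (3 / 2 : ℝ) := by
          rw [Real.le_rpow_iff_log_le (by norm_num) (by norm_num),
            div_mul_eq_mul_div, le_div_iff₀ two_pos]
          have := Real.log_le_log (by norm_num : (0 : ℝ) < 8 ^ 2) (by norm_num : (8 : ℝ) ^ 2 ≤ 6 ^ 3)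
          rw [Real.log_pow, Real.log_pow] at this
          push_cast at this
          linarith
      _ ≤ (2 * Real.pi) ^ (3 / 2 : ℝ) := by gcongr
      _ ≤ (2 * Real.pi) ^ s := Real.rpow_le_rpow_of_exponent_le (by linarith) hs
  rw [Real.mul_rpow zero_le_two Real.pi_pos.le] at h1
  rw [Real.rpow_neg zero_le_two, div_le_iff₀ (by linarith)]
  have h2 : (0 : ℝ) < 2 ^ s := by positivity
  rw [← div_eq_mul_inv, div_le_iff₀ h2]
  have h3 : (1 / 4 : ℝ) ≤ (s - 1) ^ 2 := by nlinarith
  calc (2 : ℝ) = 1 / 4 * 8 := by norm_num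
    _ ≤ (s - 1) ^ 2 * (2 ^ s * Real.pi ^ s) := by gcongr
    _ = _ := by ring

/-- for `d ≥ 3`, `h, T > 0` and the solution `ξ^(h)` of
`(d/dt)ξ^(h) = 𝓕^(h)(ξ^(h))`, `ξ^(h)(0) = ξ₀`,
`sup_{t ≥ T} |F^(h)(ξ^(h))(t) − F^(0)(ξ^(h))(t)| ≤ C_g^3 (h/T)^{d/2−1}`. -/
theorem statement15 (d : ℕ) (hd : 3 ≤ d) (f : SchwartzMap (E d) ℂ) (ξ₀ : E d) (hξ₀ : ξ₀ ≠ 0)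
    (h T : ℝ) (hh : 0 < h) (hT : 0 < T) (ξ : ℝ → E d) (hinit : ξ 0 = ξ₀)
    (hsol : ∀ t ∈ Set.Ici (0 : ℝ), HasDerivWithinAt ξ (calF f h ξ t) (Set.Ici (0 : ℝ)) t) :
    ∀ t : ℝ, T ≤ t →
      ‖Fh f h ξ t - F0pt f (ξ t)‖ ≤ Cg3 f * (h / T) ^ ((d : ℝ) / 2 - 1) := by
  intro t ht
  have hd' : (3 : ℝ) ≤ d := by exact_mod_cast hd
  have ht0 : 0 < t := hT.trans_le ht
  have ha : 0 < t / h := by positivity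
  have hL : 0 ≤ L1ftg f := integral_nonneg fun _ ↦ Real.sqrt_nonneg _
  rw [Fh_eq_intervalIntegral, F0pt_eq_add hd f (ξ t) ha, sub_add_cancel_left, norm_neg,
    integral_smul, norm_smul, norm_neg, Real.norm_two]
  have hpow : (t / h) ^ (1 - (d : ℝ) / 2) ≤ (h / T) ^ ((d : ℝ) / 2 - 1) := by
    rw [← neg_sub, Real.rpow_neg ha.le, ← Real.inv_rpow ha.le, inv_div]
    have : 0 ≤ (d : ℝ) / 2 - 1 := by linarith
    gcongr
  have hc := two_mul_two_rpow_div_le (by linarith : 3 / 2 ≤ (d : ℝ) / 2)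
  calc _ ≤ 2 * (2 ^ (-(d : ℝ) / 2) * L1ftg f *
          ((t / h) ^ (1 - (d : ℝ) / 2) / ((d : ℝ) / 2 - 1))) := by
        gcongr
        exact norm_integral_Ioi_F0inner_le hd f (ξ t) ha
    _ = 2 * 2 ^ (-((d : ℝ) / 2)) / ((d : ℝ) / 2 - 1) * L1ftg f *
          (t / h) ^ (1 - (d : ℝ) / 2) := by rw [neg_div]; ring
    _ ≤ _ := by
        have : 0 ≤ (d : ℝ) / 2 - 1 := by linarith
        rw [Cg3]
        gcongr
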